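/- Let 1 ≤ c < b ≤ a < d be integers, and β, γ, B₀, C₀ reals with 0 < γ < β. Suppose ψ(T) = T^{−β}(log(T+2))^{B₀} and φ(T) = T^{−γ}(log(T+2))^{C₀} are decreasing on [1,∞) and ψ(T) ≤ T^{−b/(d−b)} for all T ≥ 1. Let B be a b-dimensional linear subspace of ℝ^d with dist(z, B) ≥ ψ(|z|) for every nonzero z ∈ ℤ^d, and let A ⊇ B be any a-dimensional linear subspace. If either γ(d−c) > β(d−b) + c − b, or γ(d−c) = β(d−b) + c − b and C₀(d−c) − B₀(d−b) < −1, then for Lebesgue-almost every Θ ∈ ℝ^{(a−c)×c} there are only finitely many z ∈ ℤ^d \ {0} with dist(z, C(Θ)) < φ(|z|); hence almost every c-dimensional subspace of A is (ρφ)-badly approximable for some ρ > 0. -/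

import Mathlib

open MeasureTheory Filter

noncomputable section

/-- The sup-norm of a vector in Euclidean space. -/
def supNorm {d : ℕ} (w : EuclideanSpace ℝ (Fin d)) : ℝ := ⨆ i, |w i|

/-- The point of `ℝ^d` (with Euclidean metric) corresponding to an integer vector. -/
def intVec {d : ℕ} (z : Fin d → ℤ) : EuclideanSpace ℝ (Fin d) :=
  (WithLp.equiv 2 (Fin d → ℝ)).symm (fun i => (z i : ℝ))

/-- The irrationality measure function `ψ_B` of a linear subspace of `ℝ^d`:
`ψ_B(t) = inf { dist(z, B) : z ∈ ℤ^d, 1 ≤ |z| < t }`. -/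
def psiSub {d : ℕ} (B : Submodule ℝ (EuclideanSpace ℝ (Fin d))) (t : ℝ) : ℝ :=
  sInf ((fun z : Fin d → ℤ =>
      Metric.infDist (intVec z) (B : Set (EuclideanSpace ℝ (Fin d)))) ''
    {z | 1 ≤ supNorm (intVec z) ∧ supNorm (intVec z) < t})

/-- The Diophantine exponent of a linear subspace of `ℝ^d`:
`ω(B) = sup { γ : liminf_{t→∞} t^γ ψ_B(t) < ∞ }`, as an extended real number. -/
def diophExp {d : ℕ} (B : Submodule ℝ (EuclideanSpace ℝ (Fin d))) : EReal :=
  sSup {x : EReal | ∃ γ : ℝ, x = (γ : EReal) ∧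
    Filter.liminf (fun t : ℝ => ENNReal.ofReal (t ^ γ * psiSub B t)) Filter.atTop < ⊤}

/-- The graph subspace `C(Θ)` of an `(a-c)×c` matrix `Θ`, relative to an orthonormal
basis `e` of an `a`-dimensional subspace of `ℝ^d`:
`C(Θ) = { ∑ x_j e_j + ∑_i (∑_j θ_{ij} x_j) e_{c+i} : x ∈ ℝ^c }`. -/
def graphSub (d a c : ℕ) (hca : c ≤ a) (e : Fin a → EuclideanSpace ℝ (Fin d))
    (Θ : Fin (a - c) → Fin c → ℝ) : Submodule ℝ (EuclideanSpace ℝ (Fin d)) :=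
  Submodule.span ℝ {v | ∃ x : Fin c → ℝ,
    v = (∑ j : Fin c, x j • e (Fin.castLE hca j)) +
        ∑ i : Fin (a - c), (∑ j : Fin c, Θ i j * x j) • e ⟨c + i.1, by have := i.2; omega⟩}

lemma volume_strip_le {n : ℕ} (x : Fin n → ℝ) (j₀ : Fin n) (hx : x j₀ ≠ 0) (w : ℝ) {η R : ℝ}
    (hη : 0 ≤ η) (hR : 0 ≤ R) :
    volume {θ : Fin n → ℝ | (∀ j, |θ j| ≤ R) ∧ |w - ∑ j, θ j * x j| ≤ η} ≤
      ENNReal.ofReal ((2 * R) ^ (n - 1) * (2 * (η / |x j₀|))) := by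
  obtain ⟨m, rfl⟩ : ∃ m, n = m + 1 := ⟨n - 1, by have := j₀.2; omega⟩
  let g : (Fin m → ℝ) → ℝ := fun r => (w - ∑ j, r j * x (j₀.succAbove j)) / x j₀
  have hg : Continuous g := by fun_prop
  let S : Set (ℝ × (Fin m → ℝ)) :=
    {p | (∀ j, |p.2 j| ≤ R) ∧ |p.1 - g p.2| ≤ η / |x j₀|}
  have hS : IsClosed S := by
    have h1 : IsClosed {p : ℝ × (Fin m → ℝ) | ∀ j, |p.2 j| ≤ R} := by
      simp only [Set.ofPred_forall]
      exact isClosed_iInter fun j => isClosed_le (by fun_prop) continuous_const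
    have h2 : IsClosed {p : ℝ × (Fin m → ℝ) | |p.1 - g p.2| ≤ η / |x j₀|} :=
      isClosed_le (by fun_prop) continuous_const
    exact h1.inter h2
  have hsub : {θ : Fin (m + 1) → ℝ | (∀ j, |θ j| ≤ R) ∧ |w - ∑ j, θ j * x j| ≤ η} ⊆
      MeasurableEquiv.piFinSuccAbove (fun _ => ℝ) j₀ ⁻¹' S := by
    rintro θ ⟨h1, h2⟩
    refine ⟨fun j => h1 _, ?_⟩
    rw [Fin.sum_univ_succAbove _ j₀] at h2
    have hpos : 0 < |x j₀| := abs_pos.2 hx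
    rw [le_div_iff₀ hpos, ← abs_mul]
    refine le_trans (le_of_eq ?_) h2
    rw [← abs_neg]
    congr 1
    simp only [g, MeasurableEquiv.piFinSuccAbove_apply, Fin.insertNthEquiv_symm_apply,
      Fin.removeNth]
    field_simp
    ring
  refine (measure_mono hsub).trans ?_
  rw [(volume_preserving_piFinSuccAbove (fun _ => ℝ) j₀).measure_preimage
    hS.measurableSet.nullMeasurableSet, Measure.volume_eq_prod,
    Measure.prod_apply_symm hS.measurableSet]
  have hslice : ∀ r : Fin m → ℝ, volume ((fun t => (t, r)) ⁻¹' S) ≤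
      (Metric.closedBall (0 : Fin m → ℝ) R).indicator
        (fun _ => ENNReal.ofReal (2 * (η / |x j₀|))) r := by
    intro r
    by_cases hr : r ∈ Metric.closedBall (0 : Fin m → ℝ) R
    · rw [Set.indicator_of_mem hr, ← Real.volume_closedBall (g r)]
      refine measure_mono fun t ht => ?_
      simpa [Real.dist_eq] using ht.2
    · rw [Set.indicator_of_notMem hr]
      have : (fun t => (t, r)) ⁻¹' S = ∅ := by
        ext t
        simp only [Set.mem_preimage, Set.mem_empty_iff_false, iff_false]
        rintro ⟨h1, -⟩
        apply hr
        rw [mem_closedBall_zero_iff, pi_norm_le_iff_of_nonneg hR]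
        exact h1
      simp [this]
  refine (lintegral_mono hslice).trans ?_
  rw [lintegral_indicator_const Metric.isClosed_closedBall.measurableSet,
    Real.volume_pi_closedBall _ hR, ← ENNReal.ofReal_mul (by positivity)]
  simp [mul_comm]

lemma card_le_of_separated {α ι : Type*} [Fintype ι] (P : ι → α → ℝ) (X : ι → ℝ) (hX : ∀ i, 0 ≤ X i)
    {s : ℝ} (hs : 0 < s) (S : Finset α) (hS : ∀ z ∈ S, ∀ i, |P i z| ≤ X i)
    (hsep : ∀ z ∈ S, ∀ z' ∈ S, (∀ i, |P i z - P i z'| < s) → z = z') :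
    (S.card : ℝ) ≤ ∏ i, (2 * X i / s + 2) := by
  classical
  have h := Finset.card_le_card_of_injOn (s := S)
    (t := Fintype.piFinset fun i => Finset.Icc ⌊-(X i) / s⌋ ⌊X i / s⌋)
    (fun z i => ⌊P i z / s⌋) ?_ ?_
  · rw [Fintype.card_piFinset] at h
    refine (Nat.cast_le.2 h).trans ?_
    push_cast
    refine Finset.prod_le_prod (fun _ _ => by positivity) fun i _ => ?_
    rw [Int.card_Icc]
    have h1 : ⌊-(X i) / s⌋ ≤ ⌊X i / s⌋ := Int.floor_le_floor (by
      have := hX i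
      gcongr
      linarith)
    have h2 : (((⌊X i / s⌋ + 1 - ⌊-(X i) / s⌋).toNat : ℤ) : ℝ) =
        (⌊X i / s⌋ : ℝ) + 1 - ⌊-(X i) / s⌋ := by
      rw [Int.toNat_of_nonneg (by omega)]
      push_cast
      ring
    rw [← Int.cast_natCast, h2]
    have h3 := Int.floor_le (X i / s)
    have h4 := Int.lt_floor_add_one (-(X i) / s)
    have h5 : -(X i) / s = -(X i / s) := by ring
    have h6 : 2 * X i / s = 2 * (X i / s) := by ring
    rw [h6]
    rw [h5] at h4 ⊢
    linarith
  · intro z hz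
    simp only [Finset.mem_coe, Fintype.mem_piFinset, Finset.mem_Icc]
    intro i
    have := abs_le.1 (hS z hz i)
    exact ⟨Int.floor_le_floor (by gcongr; exact this.1),
      Int.floor_le_floor (by gcongr; exact this.2)⟩
  · intro z hz z' hz' heq
    refine hsep z hz z' hz' fun i => ?_
    have h1 := Int.abs_sub_lt_one_of_floor_eq_floor (congrFun heq i)
    rw [← sub_div, abs_div, abs_of_pos hs, div_lt_one hs] at h1
    exact h1

/-- The sequence `2 ^ (k α) (k + 1) ^ s`. -/
noncomputable def expPoly (α s : ℝ) (k : ℕ) : ℝ := (2 : ℝ) ^ (k * α) * ((k : ℝ) + 1) ^ s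

lemma expPoly_pos (α s : ℝ) (k : ℕ) : 0 < expPoly α s k := by
  unfold expPoly; positivity

lemma expPoly_mul (α s α' s' : ℝ) (k : ℕ) :
    expPoly α s k * expPoly α' s' k = expPoly (α + α') (s + s') k := by
  unfold expPoly
  rw [mul_add, Real.rpow_add (by norm_num), Real.rpow_add (by positivity)]
  ring

lemma expPoly_pow (α s : ℝ) (k n : ℕ) :
    expPoly α s k ^ n = expPoly (n * α) (n * s) k := by
  unfold expPoly
  rw [mul_pow, ← Real.rpow_natCast, ← Real.rpow_mul (by norm_num), ← Real.rpow_natCast (_ ^ s),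
    ← Real.rpow_mul (by positivity)]
  congr 2 <;> ring

lemma summable_expPoly {α s : ℝ} (h : α < 0 ∨ (α = 0 ∧ s < -1)) : Summable (expPoly α s) := by
  rcases h with h | ⟨rfl, h⟩
  · have hr0 : 0 < (2 : ℝ) ^ α := by positivity
    have hr : ‖(2 : ℝ) ^ α‖ < 1 := by
      rw [Real.norm_of_nonneg hr0.le]
      exact Real.rpow_lt_one_of_one_lt_of_neg (by norm_num) h
    have h1 := (summable_nat_add_iff 1).2
      (summable_pow_mul_geometric_of_norm_lt_one (R := ℝ) ⌈s⌉₊ hr)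
    refine Summable.of_nonneg_of_le (fun k => (expPoly_pos _ _ k).le) (fun k => ?_)
      (h1.mul_left ((2 : ℝ) ^ α)⁻¹)
    have h2 : ((k : ℝ) + 1) ^ s ≤ ((k : ℝ) + 1) ^ ⌈s⌉₊ := by
      rw [← Real.rpow_natCast]
      exact Real.rpow_le_rpow_of_exponent_le (by linarith [k.cast_nonneg (α := ℝ)])
        (Nat.le_ceil s)
    have h3 : (2 : ℝ) ^ (k * α) = ((2 : ℝ) ^ α)⁻¹ * ((2 : ℝ) ^ α) ^ (k + 1) := by
      rw [pow_succ, mul_comm (k : ℝ), Real.rpow_mul (by norm_num), Real.rpow_natCast]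
      field_simp
    unfold expPoly
    rw [h3]
    push_cast
    calc _ ≤ ((2 : ℝ) ^ α)⁻¹ * ((2 : ℝ) ^ α) ^ (k + 1) * ((k : ℝ) + 1) ^ ⌈s⌉₊ := by gcongr
      _ = _ := by ring
  · have h1 := (summable_nat_add_iff 1).2 (Real.summable_nat_rpow.2 h)
    refine h1.congr fun k => ?_
    simp [expPoly]

lemma exists_expPoly_le {α : ℝ} (s : ℝ) (h : α < 0) : ∃ K : ℝ, 0 < K ∧ ∀ k, expPoly α s k ≤ K := by
  have hs := summable_expPoly (s := s) (Or.inl h)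
  refine ⟨∑' k, expPoly α s k, hs.tsum_pos (fun k => (expPoly_pos _ _ k).le) 0 (expPoly_pos _ _ 0),
    fun k => hs.le_tsum k fun j _ => (expPoly_pos _ _ j).le⟩

lemma rpow_mul_log_rpow_pos (α s : ℝ) {T : ℝ} (hT : 1 ≤ T) :
    0 < T ^ α * Real.log (T + 2) ^ s := by
  have : 0 < Real.log (T + 2) := Real.log_pos (by linarith)
  positivity

lemma rpow_le_max_mul {m M x y : ℝ} (hm : 0 < m) (hx : 0 < x) (h1 : m * x ≤ y) (h2 : y ≤ M * x)
    (s : ℝ) : y ^ s ≤ max (m ^ s) (M ^ s) * x ^ s := by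
  have hM : 0 < M := hm.trans_le (le_of_mul_le_mul_right (h1.trans h2) hx)
  have hy : 0 < y := lt_of_lt_of_le (by positivity) h1
  rcases le_total 0 s with hs | hs
  · calc y ^ s ≤ (M * x) ^ s := Real.rpow_le_rpow hy.le h2 hs
      _ = M ^ s * x ^ s := Real.mul_rpow hM.le hx.le
      _ ≤ _ := by gcongr; exact le_max_right _ _
  · calc y ^ s ≤ (m * x) ^ s := Real.rpow_le_rpow_of_nonpos (by positivity) h1 hs
      _ = m ^ s * x ^ s := Real.mul_rpow hm.le hx.le
      _ ≤ _ := by gcongr; exact le_max_left _ _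

lemma exists_rpow_mul_log_rpow_le (α s : ℝ) (n : ℕ) : ∃ K : ℝ, 0 < K ∧ ∀ k : ℕ,
    ((2 : ℝ) ^ (k + n)) ^ α * Real.log ((2 : ℝ) ^ (k + n) + 2) ^ s ≤ K * expPoly α s k := by
  have hl : 0 < Real.log 2 := Real.log_pos (by norm_num)
  set m := Real.log 2 / 2
  set M := (n + 2) * Real.log 2
  refine ⟨((2 : ℝ) ^ n) ^ α * max (m ^ s) (M ^ s), by positivity, fun k => ?_⟩
  have h1 : m * ((k : ℝ) + 1) ≤ Real.log ((2 : ℝ) ^ (k + n) + 2) := by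
    have ha : Real.log 2 ≤ Real.log ((2 : ℝ) ^ (k + n) + 2) :=
      Real.log_le_log (by norm_num) (by linarith [pow_pos (two_pos (α := ℝ)) (k + n)])
    have hb : k * Real.log 2 ≤ Real.log ((2 : ℝ) ^ (k + n) + 2) := by
      rw [← Real.log_pow]
      refine Real.log_le_log (by positivity) ?_
      have := pow_le_pow_right₀ (one_le_two (α := ℝ)) (Nat.le_add_right k n)
      linarith
    simp only [m]
    linarith
  have h2 : Real.log ((2 : ℝ) ^ (k + n) + 2) ≤ M * ((k : ℝ) + 1) := by
    have ha : Real.log ((2 : ℝ) ^ (k + n) + 2) ≤ ((k + n + 2 : ℕ) : ℝ) * Real.log 2 := by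
      rw [← Real.log_pow]
      refine Real.log_le_log (by positivity) ?_
      have := one_le_pow₀ (one_le_two (α := ℝ)) (n := k + n)
      rw [pow_add _ (k + n)]
      linarith
    refine ha.trans ?_
    simp only [M]
    push_cast
    have : (0 : ℝ) ≤ (n + 1) * k * Real.log 2 := by positivity
    linarith
  have h3 := rpow_le_max_mul (by positivity) (by positivity) h1 h2 s
  have h4 : ((2 : ℝ) ^ (k + n)) ^ α = ((2 : ℝ) ^ n) ^ α * (2 : ℝ) ^ (k * α) := by
    rw [pow_add, Real.mul_rpow (by positivity) (by positivity), mul_comm,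
      Real.rpow_mul (by norm_num), Real.rpow_natCast]
  rw [h4]
  unfold expPoly
  calc _ ≤ ((2 : ℝ) ^ n) ^ α * (2 : ℝ) ^ (k * α) *
        (max (m ^ s) (M ^ s) * ((k : ℝ) + 1) ^ s) := by gcongr
    _ = _ := by ring

lemma mem_graphSub_iff {d a c : ℕ} (hca : c ≤ a) (e : Fin a → EuclideanSpace ℝ (Fin d))
    (Θ : Fin (a - c) → Fin c → ℝ) (u : EuclideanSpace ℝ (Fin d)) :
    u ∈ graphSub d a c hca e Θ ↔ ∃ x : Fin c → ℝ,
      u = (∑ j : Fin c, x j • e (Fin.castLE hca j)) +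
        ∑ i : Fin (a - c), (∑ j : Fin c, Θ i j * x j) • e ⟨c + i.1, by have := i.2; omega⟩ := by
  refine ⟨fun hu => ?_, fun hu => Submodule.subset_span hu⟩
  induction hu using Submodule.span_induction with
  | mem u hu => exact hu
  | zero => exact ⟨0, by simp⟩
  | add u v _ _ hu hv =>
    obtain ⟨x, rfl⟩ := hu
    obtain ⟨y, rfl⟩ := hv
    refine ⟨x + y, ?_⟩
    simp only [Pi.add_apply, add_smul, mul_add, Finset.sum_add_distrib]
    abel
  | smul t u _ hu =>
    obtain ⟨x, rfl⟩ := hu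
    refine ⟨t • x, ?_⟩
    simp only [Pi.smul_apply, smul_add, Finset.smul_sum, smul_smul, smul_eq_mul, Finset.mul_sum,
      mul_left_comm t]

lemma graphSub_le_span {d a c : ℕ} (hca : c ≤ a) (e : Fin a → EuclideanSpace ℝ (Fin d))
    (Θ : Fin (a - c) → Fin c → ℝ) : graphSub d a c hca e Θ ≤ Submodule.span ℝ (Set.range e) := by
  intro u hu
  obtain ⟨x, rfl⟩ := (mem_graphSub_iff hca e Θ u).1 hu
  exact Submodule.add_mem _
    (Submodule.sum_mem _ fun j _ => Submodule.smul_mem _ _ (Submodule.subset_span ⟨_, rfl⟩))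
    (Submodule.sum_mem _ fun j _ => Submodule.smul_mem _ _ (Submodule.subset_span ⟨_, rfl⟩))

lemma exists_approx_of_infDist_graphSub_lt {d a c : ℕ} (hca : c ≤ a)
    {e : Fin a → EuclideanSpace ℝ (Fin d)} (he : Orthonormal ℝ e) {Θ : Fin (a - c) → Fin c → ℝ}
    {R : ℝ} (hΘ : ∀ i j, |Θ i j| ≤ R) {v : EuclideanSpace ℝ (Fin d)} {ε : ℝ}
    (hv : Metric.infDist v (graphSub d a c hca e Θ : Set (EuclideanSpace ℝ (Fin d))) < ε) :
    ∃ x : Fin c → ℝ, (∀ j, |inner ℝ (e (Fin.castLE hca j)) v - x j| < ε) ∧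
      (∀ i : Fin (a - c), |inner ℝ (e ⟨c + i.1, by have := i.2; omega⟩) v - ∑ j, Θ i j * x j| < ε) ∧
      ‖v‖ < ε + (1 + (a - c : ℕ) * R) * ∑ j, |x j| := by
  obtain ⟨u, hu, huv⟩ := (Metric.infDist_lt_iff ⟨0, Submodule.zero_mem _⟩).1 hv
  obtain ⟨x, hx⟩ := (mem_graphSub_iff hca e Θ u).1 hu
  rw [dist_eq_norm] at huv
  have he1 : Orthonormal ℝ fun j : Fin c => e (Fin.castLE hca j) :=
    he.comp _ (Fin.castLE_injective hca)
  have he2 : Orthonormal ℝ fun i : Fin (a - c) => e ⟨c + i.1, by have := i.2; omega⟩ :=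
    he.comp (fun i : Fin (a - c) => (⟨c + i.1, by have := i.2; omega⟩ : Fin a))
      (fun i i' h => by simp only [Fin.mk.injEq] at h; exact Fin.ext (by omega))
  have he3 : ∀ (j : Fin c) (i : Fin (a - c)),
      inner ℝ (e (Fin.castLE hca j)) (e ⟨c + i.1, by have := i.2; omega⟩) = 0 := fun j i =>
    he.2 (fun h => by
      have h1 : j.1 = c + i.1 := congrArg Fin.val h
      have := j.2
      omega)
  have hbound : ∀ k, |inner ℝ (e k) v - inner ℝ (e k) u| < ε := fun k => by
    rw [← inner_sub_right]
    refine lt_of_le_of_lt (abs_real_inner_le_norm _ _) ?_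
    rwa [he.1 k, one_mul]
  refine ⟨x, fun j => ?_, fun i => ?_, ?_⟩
  · have h := hbound (Fin.castLE hca j)
    have h2 : inner ℝ (e (Fin.castLE hca j)) u = x j := by
      rw [hx, inner_add_right, he1.inner_right_fintype, inner_sum]
      simp [inner_smul_right, he3]
    rwa [h2] at h
  · have h := hbound ⟨c + i.1, by have := i.2; omega⟩
    have h2 : inner ℝ (e ⟨c + i.1, by have := i.2; omega⟩) u = ∑ j, Θ i j * x j := by
      rw [hx, inner_add_right, he2.inner_right_fintype (fun i => ∑ j, Θ i j * x j), inner_sum]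
      simp [real_inner_comm _ (e ⟨c + i.1, _⟩), inner_smul_left, he3]
    rwa [h2] at h
  · have h1 : ‖u‖ ≤ (1 + (a - c : ℕ) * R) * ∑ j, |x j| := by
      rw [hx]
      have h2 : ‖∑ j : Fin c, x j • e (Fin.castLE hca j)‖ ≤ ∑ j, |x j| :=
        norm_sum_le_of_le _ fun j _ => by rw [norm_smul, he.1, mul_one, Real.norm_eq_abs]
      have h3 : ‖∑ i : Fin (a - c), (∑ j : Fin c, Θ i j * x j) •
          e ⟨c + i.1, by have := i.2; omega⟩‖ ≤ ∑ i : Fin (a - c), R * ∑ j, |x j| :=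
        norm_sum_le_of_le _ fun i _ => by
          rw [norm_smul, he.1, mul_one, Real.norm_eq_abs, Finset.mul_sum]
          refine (Finset.abs_sum_le_sum_abs _ _).trans (Finset.sum_le_sum fun j _ => ?_)
          rw [abs_mul]
          exact mul_le_mul_of_nonneg_right (hΘ i j) (abs_nonneg _)
      rw [Finset.sum_const, Finset.card_univ, Fintype.card_fin, nsmul_eq_mul] at h3
      refine (norm_add_le _ _).trans ((add_le_add h2 h3).trans (le_of_eq (by ring)))
    have h4 : ‖v‖ ≤ ‖v - u‖ + ‖u‖ := by simpa using norm_add_le (v - u) u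
    linarith

/-- The slabs of parameters `Θ` in a box for which `v` is `ε`-close to `C(Θ)` have volume
`O((ε / ‖v‖) ^ (a - c))`. -/
lemma exists_volume_infDist_graphSub_lt_le {d a c : ℕ} (hc : 1 ≤ c) (hca : c ≤ a)
    {e : Fin a → EuclideanSpace ℝ (Fin d)} (he : Orthonormal ℝ e) {R : ℝ} (hR : 0 ≤ R) :
    ∃ K : ℝ, 0 < K ∧ ∀ v : EuclideanSpace ℝ (Fin d), v ≠ 0 → ∀ ε : ℝ, 0 < ε →
      volume {Θ : Fin (a - c) → Fin c → ℝ | (∀ i j, |Θ i j| ≤ R) ∧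
        Metric.infDist v (graphSub d a c hca e Θ : Set (EuclideanSpace ℝ (Fin d))) < ε} ≤
      ENNReal.ofReal (K * (ε / ‖v‖) ^ (a - c)) := by
  set L : ℝ := c * (1 + (a - c : ℕ) * R) with hL
  set M : ℝ := 1 + c * R with hM
  have hc' : (1 : ℝ) ≤ c := by exact_mod_cast hc
  have hL1 : 1 ≤ L := by
    have : 0 ≤ ((a - c : ℕ) : ℝ) * R := by positivity
    nlinarith
  refine ⟨1 + ((2 * R) ^ (c - 1) * (8 * L * M)) ^ (a - c) + ((2 * R) ^ c * (4 * L)) ^ (a - c),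
    by positivity, fun v hv ε hε => ?_⟩
  have hv0 : 0 < ‖v‖ := norm_pos_iff.2 hv
  have hprod : ∀ (S : Fin (a - c) → Set (Fin c → ℝ)) (t : ℝ), 0 ≤ t →
      (∀ i, volume (S i) ≤ ENNReal.ofReal t) →
      volume (Set.univ.pi S) ≤ ENNReal.ofReal (t ^ (a - c)) := by
    intro S t ht h
    rw [volume_pi_pi, ENNReal.ofReal_pow ht]
    refine (Finset.prod_le_prod' fun i _ => h i).trans ?_
    simp
  by_cases hA : ∃ j, ‖v‖ / (4 * L) ≤ |inner ℝ (e (Fin.castLE hca j)) v|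
  · obtain ⟨j₀, hj₀⟩ := hA
    have hx0 : 0 < |inner ℝ (e (Fin.castLE hca j₀)) v| := lt_of_lt_of_le (by positivity) hj₀
    have hsub : {Θ : Fin (a - c) → Fin c → ℝ | (∀ i j, |Θ i j| ≤ R) ∧
        Metric.infDist v (graphSub d a c hca e Θ : Set (EuclideanSpace ℝ (Fin d))) < ε} ⊆
        Set.univ.pi fun i => {θ : Fin c → ℝ | (∀ j, |θ j| ≤ R) ∧
          |inner ℝ (e ⟨c + i.1, by have := i.2; omega⟩) v -
            ∑ j, θ j * inner ℝ (e (Fin.castLE hca j)) v| ≤ M * ε} := by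
      rintro Θ ⟨hΘ, hd⟩ i -
      obtain ⟨x, h1, h2, -⟩ := exists_approx_of_infDist_graphSub_lt hca he hΘ hd
      refine ⟨hΘ i, ?_⟩
      have h3 : |∑ j, Θ i j * (inner ℝ (e (Fin.castLE hca j)) v - x j)| ≤ ∑ j : Fin c, R * ε := by
        refine (Finset.abs_sum_le_sum_abs _ _).trans (Finset.sum_le_sum fun j _ => ?_)
        rw [abs_mul]
        exact mul_le_mul (hΘ i j) (h1 j).le (abs_nonneg _) hR
      rw [Finset.sum_const, Finset.card_univ, Fintype.card_fin, nsmul_eq_mul] at h3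
      have h4 := h2 i
      simp only [mul_sub, Finset.sum_sub_distrib] at h3
      rw [abs_le] at h3 ⊢
      rw [abs_lt] at h4
      constructor <;> · simp only [hM]; linarith
    refine (measure_mono hsub).trans ((hprod _ ((2 * R) ^ (c - 1) * (8 * L * M) * (ε / ‖v‖))
      (by positivity) fun i => ?_).trans (ENNReal.ofReal_le_ofReal ?_))
    · refine (volume_strip_le _ j₀ (abs_pos.1 hx0) _ (by positivity) hR).trans
        (ENNReal.ofReal_le_ofReal ?_)
      rw [mul_assoc]
      refine mul_le_mul_of_nonneg_left ?_ (by positivity)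
      calc 2 * (M * ε / |inner ℝ (e (Fin.castLE hca j₀)) v|)
          ≤ 2 * (M * ε / (‖v‖ / (4 * L))) := by gcongr
        _ = _ := by field_simp; ring
    · rw [mul_pow]
      gcongr
      have : 0 ≤ ((2 * R) ^ c * (4 * L)) ^ (a - c) := by positivity
      linarith
  · push Not at hA
    rcases le_or_gt ε (‖v‖ / (4 * L)) with hε' | hε'
    · refine (measure_mono (t := ∅) ?_).trans (by simp)
      rintro Θ ⟨hΘ, hd⟩
      exfalso
      obtain ⟨x, h1, -, h3⟩ := exists_approx_of_infDist_graphSub_lt hca he hΘ hd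
      have h4 : ∑ j, |x j| ≤ ∑ j : Fin c, ‖v‖ / (2 * L) := Finset.sum_le_sum fun j _ => by
        have h5 := h1 j
        have h6 := hA j
        have h7 : ‖v‖ / (2 * L) = ‖v‖ / (4 * L) + ‖v‖ / (4 * L) := by field_simp; norm_num
        rw [abs_lt] at h5 h6
        rw [abs_le, h7]
        constructor <;> linarith
      rw [Finset.sum_const, Finset.card_univ, Fintype.card_fin, nsmul_eq_mul] at h4
      have h8 : (1 + (a - c : ℕ) * R) * ∑ j, |x j| ≤ ‖v‖ / 2 := by
        calc _ ≤ (1 + (a - c : ℕ) * R) * (c * (‖v‖ / (2 * L))) := by gcongr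
          _ = L * (‖v‖ / (2 * L)) := by rw [hL]; ring
          _ = _ := by field_simp
      have h9 : ‖v‖ / (4 * L) ≤ ‖v‖ / 4 := by
        gcongr
        linarith
      linarith
    · have hsub : {Θ : Fin (a - c) → Fin c → ℝ | (∀ i j, |Θ i j| ≤ R) ∧
          Metric.infDist v (graphSub d a c hca e Θ : Set (EuclideanSpace ℝ (Fin d))) < ε} ⊆
          Set.univ.pi fun _ => Metric.closedBall 0 R := by
        rintro Θ ⟨hΘ, -⟩ i -
        rw [mem_closedBall_zero_iff, pi_norm_le_iff_of_nonneg hR]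
        exact hΘ i
      refine (measure_mono hsub).trans ((hprod _ ((2 * R) ^ c * (4 * L) * (ε / ‖v‖))
        (by positivity) fun i => ?_).trans (ENNReal.ofReal_le_ofReal ?_))
      · rw [Real.volume_pi_closedBall _ hR, Fintype.card_fin]
        refine ENNReal.ofReal_le_ofReal ?_
        rw [mul_assoc]
        refine le_mul_of_one_le_right (by positivity) ?_
        rw [div_lt_iff₀ (by positivity)] at hε'
        rw [← mul_div_assoc, le_div_iff₀ hv0]
        linarith
      · rw [mul_pow]
        gcongr
        have : 0 ≤ ((2 * R) ^ (c - 1) * (8 * L * M)) ^ (a - c) := by positivity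
        linarith

lemma abs_le_supNorm {d : ℕ} (w : EuclideanSpace ℝ (Fin d)) (i : Fin d) : |w i| ≤ supNorm w :=
  le_ciSup (f := fun i => |w i|) (Set.finite_range _).bddAbove i

lemma supNorm_le {d : ℕ} {w : EuclideanSpace ℝ (Fin d)} {r : ℝ} (hr : 0 ≤ r)
    (h : ∀ i, |w i| ≤ r) : supNorm w ≤ r :=
  Real.iSup_le h hr

lemma supNorm_nonneg {d : ℕ} (w : EuclideanSpace ℝ (Fin d)) : 0 ≤ supNorm w :=
  Real.iSup_nonneg fun _ => abs_nonneg _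

lemma supNorm_sub_le {d : ℕ} (u v : EuclideanSpace ℝ (Fin d)) :
    supNorm (u - v) ≤ supNorm u + supNorm v := by
  refine supNorm_le (add_nonneg (supNorm_nonneg _) (supNorm_nonneg _)) fun i => ?_
  rw [PiLp.sub_apply]
  exact (abs_sub _ _).trans (add_le_add (abs_le_supNorm u i) (abs_le_supNorm v i))

lemma supNorm_le_norm {d : ℕ} (w : EuclideanSpace ℝ (Fin d)) : supNorm w ≤ ‖w‖ :=
  supNorm_le (norm_nonneg _) fun i => PiLp.norm_apply_le w i

lemma norm_le_mul_supNorm {d : ℕ} (w : EuclideanSpace ℝ (Fin d)) : ‖w‖ ≤ d * supNorm w := by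
  conv_lhs => rw [← (EuclideanSpace.basisFun (Fin d) ℝ).sum_repr w]
  have h : (d : ℝ) * supNorm w = ∑ _i : Fin d, supNorm w := by simp
  rw [h]
  refine norm_sum_le_of_le _ fun i _ => ?_
  rw [norm_smul, (EuclideanSpace.basisFun (Fin d) ℝ).orthonormal.1, mul_one]
  exact abs_le_supNorm w i

lemma intVec_apply {d : ℕ} (z : Fin d → ℤ) (i : Fin d) : intVec z i = z i := rfl

lemma intVec_sub {d : ℕ} (z z' : Fin d → ℤ) : intVec (z - z') = intVec z - intVec z' := by
  ext i
  simp [intVec_apply]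

lemma one_le_supNorm_intVec {d : ℕ} {z : Fin d → ℤ} (hz : z ≠ 0) : 1 ≤ supNorm (intVec z) := by
  obtain ⟨i, hi⟩ := Function.ne_iff.1 hz
  refine le_trans ?_ (abs_le_supNorm _ i)
  rw [intVec_apply, ← Int.cast_abs]
  exact_mod_cast Int.one_le_abs hi

lemma intVec_ne_zero {d : ℕ} {z : Fin d → ℤ} (hz : z ≠ 0) : intVec z ≠ 0 := fun h => by
  have h1 := (one_le_supNorm_intVec hz).trans (supNorm_le_norm _)
  rw [h, norm_zero] at h1
  linarith

lemma finite_supNorm_intVec_lt {d : ℕ} (r : ℝ) :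
    {z : Fin d → ℤ | supNorm (intVec z) < r}.Finite := by
  refine (Set.Finite.pi' fun _ : Fin d => Set.finite_Icc (-⌈r⌉) ⌈r⌉).subset fun z hz i => ?_
  have h1 : (|z i| : ℝ) < r := (abs_le_supNorm (intVec z) i).trans_lt hz
  have h2 := Int.le_ceil r
  have h3 : |z i| ≤ ⌈r⌉ := by
    rw [← Int.cast_abs] at h1
    exact_mod_cast h1.le.trans h2
  exact abs_le.1 h3

section Orthogonal

variable {E : Type*} [NormedAddCommGroup E] [InnerProductSpace ℝ E]

lemma norm_le_sum_abs_inner {ι : Type*} [Fintype ι] {W : Submodule ℝ E}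
    (f : OrthonormalBasis ι ℝ W) {w : E} (hw : w ∈ W) :
    ‖w‖ ≤ ∑ i, |inner ℝ (f i : E) w| := by
  have h := congrArg (Subtype.val) (f.sum_repr' ⟨w, hw⟩)
  rw [Submodule.coe_sum] at h
  conv_lhs => rw [show w = _ from h.symm]
  refine norm_sum_le_of_le _ fun i _ => ?_
  rw [Submodule.coe_smul, norm_smul, ← Submodule.coe_norm, f.orthonormal.1, mul_one]
  rfl

lemma infDist_le_sum_abs_inner [FiniteDimensional ℝ E] {ι κ : Type*} [Fintype ι] [Fintype κ]
    {B A : Submodule ℝ E} (f : OrthonormalBasis ι ℝ (Bᗮ ⊓ A : Submodule ℝ E))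
    (g : OrthonormalBasis κ ℝ Aᗮ) (hBA : B ≤ A) (v : E) :
    Metric.infDist v (B : Set E) ≤
      ∑ i, |inner ℝ (f i : E) v| + ∑ j, |inner ℝ (g j : E) v| := by
  set u := A.starProjection v
  set t := B.starProjection u
  have hu : u ∈ A := A.starProjection_apply_mem v
  have ht : t ∈ B := B.starProjection_apply_mem u
  have h1 : v - u ∈ Aᗮ := A.sub_starProjection_mem_orthogonal v
  have h2 : u - t ∈ Bᗮ ⊓ A :=
    ⟨B.sub_starProjection_mem_orthogonal u, A.sub_mem hu (hBA ht)⟩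
  have h3 := norm_le_sum_abs_inner f h2
  have h4 := norm_le_sum_abs_inner g h1
  have h5 : ∀ i, inner ℝ (f i : E) (u - t) = inner ℝ (f i : E) v := fun i => by
    have ha : inner ℝ (f i : E) (v - u) = 0 :=
      Submodule.inner_right_of_mem_orthogonal (f i).2.2 h1
    have hb : inner ℝ (f i : E) t = 0 := Submodule.inner_left_of_mem_orthogonal ht (f i).2.1
    rw [inner_sub_right] at ha ⊢
    linarith
  have h6 : ∀ j, inner ℝ (g j : E) (v - u) = inner ℝ (g j : E) v := fun j => by
    rw [inner_sub_right, Submodule.inner_left_of_mem_orthogonal hu (g j).2, sub_zero]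
  simp only [h5] at h3
  simp only [h6] at h4
  calc Metric.infDist v (B : Set E) ≤ dist v t := Metric.infDist_le_dist_of_mem ht
    _ = ‖(v - u) + (u - t)‖ := by rw [dist_eq_norm]; congr 1; abel
    _ ≤ ‖v - u‖ + ‖u - t‖ := norm_add_le _ _
    _ ≤ _ := by linarith

lemma abs_inner_le_infDist {A : Submodule ℝ E} {g : E} (hg : g ∈ Aᗮ) (hg1 : ‖g‖ = 1) (v : E) :
    |inner ℝ g v| ≤ Metric.infDist v (A : Set E) := by
  refine (Metric.le_infDist ⟨0, A.zero_mem⟩).2 fun u hu => ?_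
  have h1 : inner ℝ g v = inner ℝ g (v - u) := by
    rw [inner_sub_right, Submodule.inner_left_of_mem_orthogonal hu hg, sub_zero]
  rw [h1, dist_eq_norm, ← one_mul ‖v - u‖, ← hg1]
  exact abs_real_inner_le_norm _ _

end Orthogonal

/-- Points close to `A` whose differences are far from `B ≤ A` are few. -/
lemma card_le_of_le_infDist {d a b : ℕ} {B A : Submodule ℝ (EuclideanSpace ℝ (Fin d))}
    (hBA : B ≤ A) (hdimB : Module.finrank ℝ B = b) (hdimA : Module.finrank ℝ A = a)
    {X Y t : ℝ} (hX : 0 ≤ X) (hY : 0 ≤ Y) (ht : 0 < t) (S : Finset (Fin d → ℤ))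
    (hSX : ∀ z ∈ S, ‖intVec z‖ ≤ X)
    (hSY : ∀ z ∈ S, Metric.infDist (intVec z) (A : Set (EuclideanSpace ℝ (Fin d))) ≤ Y)
    (hsep : ∀ z ∈ S, ∀ z' ∈ S, z ≠ z' →
      t ≤ Metric.infDist (intVec (z - z')) (B : Set (EuclideanSpace ℝ (Fin d)))) :
    (S.card : ℝ) ≤ (2 * X / (t / (d + 1)) + 2) ^ (a - b) * (2 * Y / (t / (d + 1)) + 2) ^ (d - a) := by
  let f := stdOrthonormalBasis ℝ (Bᗮ ⊓ A : Submodule ℝ (EuclideanSpace ℝ (Fin d)))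
  let g := stdOrthonormalBasis ℝ Aᗮ
  have hf : Module.finrank ℝ (Bᗮ ⊓ A : Submodule ℝ (EuclideanSpace ℝ (Fin d))) = a - b := by
    have := Submodule.finrank_add_inf_finrank_orthogonal hBA
    omega
  have hA : a + Module.finrank ℝ Aᗮ = d := by
    have := A.finrank_add_finrank_orthogonal
    rwa [hdimA, finrank_euclideanSpace_fin] at this
  have hba : b ≤ a := by
    rw [← hdimB, ← hdimA]
    exact Submodule.finrank_mono hBA
  have hg : Module.finrank ℝ Aᗮ = d - a := by omega
  have hfn : ∀ i, ‖(f i : EuclideanSpace ℝ (Fin d))‖ = 1 := fun i => f.orthonormal.1 i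
  have hgn : ∀ i, ‖(g i : EuclideanSpace ℝ (Fin d))‖ = 1 := fun i => g.orthonormal.1 i
  have h := card_le_of_separated
    (Sum.elim (fun i z => inner ℝ (f i : EuclideanSpace ℝ (Fin d)) (intVec z))
      (fun j z => inner ℝ (g j : EuclideanSpace ℝ (Fin d)) (intVec z)))
    (Sum.elim (fun _ => X) (fun _ => Y)) (by rintro (i | i) <;> simpa) (s := t / (d + 1))
    (by positivity) S ?_ ?_
  · rw [Fintype.prod_sum_type] at h
    simpa [hf, hg] using h
  · rintro z hz (i | i)
    · refine (abs_real_inner_le_norm _ _).trans ?_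
      rw [hfn, one_mul]
      exact hSX z hz
    · exact (abs_inner_le_infDist (g i).2 (hgn i) _).trans (hSY z hz)
  · intro z hz z' hz' hi
    by_contra hne
    have h1 := hsep z hz z' hz' hne
    have h2 := infDist_le_sum_abs_inner f g hBA (intVec (z - z'))
    have h3 : ∑ i, |inner ℝ (f i : EuclideanSpace ℝ (Fin d)) (intVec (z - z'))| ≤
        (a - b : ℕ) * (t / (d + 1)) := by
      refine (Finset.sum_le_card_nsmul _ _ (t / (d + 1)) fun i _ => ?_).trans_eq (by simp [hf])
      rw [intVec_sub, inner_sub_right]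
      exact (hi (Sum.inl i)).le
    have h4 : ∑ i, |inner ℝ (g i : EuclideanSpace ℝ (Fin d)) (intVec (z - z'))| ≤
        (d - a : ℕ) * (t / (d + 1)) := by
      refine (Finset.sum_le_card_nsmul _ _ (t / (d + 1)) fun i _ => ?_).trans_eq (by simp [hg])
      rw [intVec_sub, inner_sub_right]
      exact (hi (Sum.inr i)).le
    have h5 : ((a - b : ℕ) : ℝ) + (d - a : ℕ) ≤ d := by
      exact_mod_cast (by omega : (a - b) + (d - a) ≤ d)
    have h6 : (0 : ℝ) < t / (d + 1) := by positivity
    have h7 : (d + 1) * (t / (d + 1)) = t := by field_simp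
    nlinarith [mul_le_mul_of_nonneg_right h5 h6.le]

lemma exists_one_le_mul_expPoly {α : ℝ} (s : ℝ) (h : 0 < α) :
    ∃ K : ℝ, 0 < K ∧ ∀ k, 1 ≤ K * expPoly α s k := by
  obtain ⟨K, hK, hle⟩ := exists_expPoly_le (-s) (neg_lt_zero.2 h)
  refine ⟨K, hK, fun k => ?_⟩
  have h1 : expPoly (-α) (-s) k * expPoly α s k = 1 := by
    rw [expPoly_mul]
    simp [expPoly]
  rw [← h1]
  exact mul_le_mul_of_nonneg_right (hle k) (expPoly_pos _ _ k).le

lemma exists_mul_mul_add_two_le {α s α' s' C K K' : ℝ} (h : 0 < α + α') (hC : 0 ≤ C) (hK : 0 < K)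
    (hK' : 0 < K') {x y : ℕ → ℝ} (hy0 : ∀ k, 0 ≤ y k)
    (hx : ∀ k, x k ≤ K * expPoly α s k) (hy : ∀ k, y k ≤ K' * expPoly α' s' k) :
    ∃ L : ℝ, 0 < L ∧ ∀ k, C * (x k * y k) + 2 ≤ L * expPoly (α + α') (s + s') k := by
  obtain ⟨M, hM, hle⟩ := exists_one_le_mul_expPoly (s + s') h
  refine ⟨C * (K * K') + 2 * M, by positivity, fun k => ?_⟩
  have h1 : x k * y k ≤ (K * expPoly α s k) * (K' * expPoly α' s' k) :=
    mul_le_mul (hx k) (hy k) (hy0 k) (mul_pos hK (expPoly_pos _ _ k)).le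
  have h2 : (K * expPoly α s k) * (K' * expPoly α' s' k) =
      K * K' * expPoly (α + α') (s + s') k := by
    rw [← expPoly_mul]
    ring
  rw [h2] at h1
  have h3 := mul_le_mul_of_nonneg_left h1 hC
  linarith [hle k]

lemma finite_of_finite_dyadic {d : ℕ} (S : Set (Fin d → ℤ)) (h0 : ∀ z ∈ S, z ≠ 0)
    (h : {k : ℕ | ∃ z ∈ S, 2 ^ k ≤ supNorm (intVec z) ∧ supNorm (intVec z) < 2 ^ (k + 1)}.Finite) :
    S.Finite := by
  refine (h.biUnion fun k _ => finite_supNorm_intVec_lt (d := d) (2 ^ (k + 1))).subset fun z hz => ?_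
  obtain ⟨k, hk1, hk2⟩ := exists_nat_pow_near (one_le_supNorm_intVec (h0 z hz)) one_lt_two
  exact Set.mem_biUnion (x := k) ⟨z, hz, hk1, hk2⟩ hk2

/-- The convergence half of the Borel–Cantelli argument on a bounded set of parameters. -/
lemma ae_finite_infDist_graphSub_lt {d a b c : ℕ} (hc : 1 ≤ c) (hba : b ≤ a)
    (had : a < d) {β γ B₀ C₀ : ℝ} (hγpos : 0 < γ) (hγβ : γ < β)
    (hψanti : AntitoneOn (fun T : ℝ => T ^ (-β) * Real.log (T + 2) ^ B₀) (Set.Ici 1))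
    (hφanti : AntitoneOn (fun T : ℝ => T ^ (-γ) * Real.log (T + 2) ^ C₀) (Set.Ici 1))
    {B A : Submodule ℝ (EuclideanSpace ℝ (Fin d))} (hBA : B ≤ A)
    (hdimB : Module.finrank ℝ B = b) (hdimA : Module.finrank ℝ A = a)
    (hbad : ∀ z : Fin d → ℤ, z ≠ 0 →
      supNorm (intVec z) ^ (-β) * Real.log (supNorm (intVec z) + 2) ^ B₀ ≤
        Metric.infDist (intVec z) (B : Set (EuclideanSpace ℝ (Fin d))))
    {e : Fin a → EuclideanSpace ℝ (Fin d)} (he : Orthonormal ℝ e)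
    (hspan : Submodule.span ℝ (Set.range e) = A)
    (hcond :
      γ * ((d : ℝ) - (c : ℝ)) > β * ((d : ℝ) - (b : ℝ)) + (c : ℝ) - (b : ℝ) ∨
      (γ * ((d : ℝ) - (c : ℝ)) = β * ((d : ℝ) - (b : ℝ)) + (c : ℝ) - (b : ℝ) ∧
        C₀ * ((d : ℝ) - (c : ℝ)) - B₀ * ((d : ℝ) - (b : ℝ)) < -1))
    (hca : c ≤ a) {R : ℝ} (hR : 0 ≤ R) :
    ∀ᵐ Θ ∂(volume : Measure (Fin (a - c) → Fin c → ℝ)), (∀ i j, |Θ i j| ≤ R) →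
      {z : Fin d → ℤ | z ≠ 0 ∧
          Metric.infDist (intVec z)
            (graphSub d a c hca e Θ : Set (EuclideanSpace ℝ (Fin d))) <
            supNorm (intVec z) ^ (-γ) * Real.log (supNorm (intVec z) + 2) ^ C₀}.Finite := by
  set φ : ℝ → ℝ := fun T => T ^ (-γ) * Real.log (T + 2) ^ C₀ with hφ
  set ψ : ℝ → ℝ := fun T => T ^ (-β) * Real.log (T + 2) ^ B₀ with hψ
  have hφpos : ∀ T, 1 ≤ T → 0 < φ T := fun T hT => rpow_mul_log_rpow_pos _ _ hT
  have hψpos : ∀ T, 1 ≤ T → 0 < ψ T := fun T hT => rpow_mul_log_rpow_pos _ _ hT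
  have hone : ∀ k : ℕ, (1 : ℝ) ≤ 2 ^ k := fun k => one_le_pow₀ one_le_two
  obtain ⟨Kφ, hKφ, hφle⟩ := exists_rpow_mul_log_rpow_le (-γ) C₀ 0
  obtain ⟨Kψ, hKψ, hψle⟩ := exists_rpow_mul_log_rpow_le β (-B₀) 2
  have hψinv : ∀ k : ℕ, (ψ (2 ^ (k + 2)))⁻¹ ≤ Kψ * expPoly β (-B₀) k := fun k => by
    refine le_of_eq_of_le ?_ (hψle k)
    have : 0 < Real.log ((2 : ℝ) ^ (k + 2) + 2) := Real.log_pos (by linarith [hone (k + 2)])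
    simp only [hψ]
    rw [mul_inv, ← Real.rpow_neg (by positivity), ← Real.rpow_neg this.le, neg_neg]
  have hψinv0 : ∀ k : ℕ, 0 ≤ (ψ (2 ^ (k + 2)))⁻¹ := fun k => (inv_pos.2 (hψpos _ (hone _))).le
  have hpow : ∀ k : ℕ, (2 : ℝ) ^ k ≤ 1 * expPoly 1 0 k := fun k => by simp [expPoly]
  obtain ⟨K₁, hK₁, hle₁⟩ := exists_mul_mul_add_two_le (C := 4 * d * (d + 1)) (x := fun k => 2 ^ k)
    (by linarith) (by positivity) one_pos hKψ hψinv0 hpow hψinv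
  obtain ⟨K₂, hK₂, hle₂⟩ := exists_mul_mul_add_two_le (C := 2 * (d + 1)) (x := fun k => φ (2 ^ k))
    (by linarith) (by positivity) hKφ hKψ hψinv0 hφle hψinv
  obtain ⟨K₃, hK₃, hle₃⟩ := exists_volume_infDist_graphSub_lt_le hc hca he hR
  have hle₄ : ∀ k : ℕ, φ (2 ^ k) / 2 ^ k ≤ Kφ * expPoly (-γ + -1) (C₀ + 0) k := fun k => by
    rw [← expPoly_mul, div_eq_mul_inv, ← mul_assoc]
    refine mul_le_mul (hφle k) (le_of_eq ?_) (by positivity)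
      (mul_pos hKφ (expPoly_pos _ _ k)).le
    simp [expPoly, Real.rpow_neg]
  let Z : ℕ → Set (Fin d → ℤ) := fun k =>
    {z | (2 : ℝ) ^ k ≤ supNorm (intVec z) ∧ supNorm (intVec z) < 2 ^ (k + 1) ∧
      Metric.infDist (intVec z) (A : Set (EuclideanSpace ℝ (Fin d))) ≤ φ (2 ^ k)}
  have hZfin : ∀ k, (Z k).Finite := fun k =>
    (finite_supNorm_intVec_lt (2 ^ (k + 1))).subset fun z hz => hz.2.1
  have hcard : ∀ k, ((hZfin k).toFinset.card : ℝ) ≤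
      (K₁ * expPoly (1 + β) (0 + -B₀) k) ^ (a - b) *
        (K₂ * expPoly (-γ + β) (C₀ + -B₀) k) ^ (d - a) := fun k => by
    have ht := hψpos (2 ^ (k + 2)) (hone _)
    have hφk := hφpos (2 ^ k) (hone _)
    refine (card_le_of_le_infDist hBA hdimB hdimA (X := d * 2 ^ (k + 1)) (Y := φ (2 ^ k))
      (by positivity) hφk.le ht _ ?_ ?_ ?_).trans ?_
    · intro z hz
      rw [Set.Finite.mem_toFinset] at hz
      exact (norm_le_mul_supNorm _).trans (mul_le_mul_of_nonneg_left hz.2.1.le (by positivity))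
    · intro z hz
      rw [Set.Finite.mem_toFinset] at hz
      exact hz.2.2
    · intro z hz z' hz' hne
      rw [Set.Finite.mem_toFinset] at hz hz'
      have h0 : z - z' ≠ 0 := sub_ne_zero.2 hne
      refine le_trans ?_ (hbad _ h0)
      refine hψanti (one_le_supNorm_intVec h0) (hone _) ?_
      rw [intVec_sub]
      refine (supNorm_sub_le _ _).trans ((add_le_add hz.2.1.le hz'.2.1.le).trans_eq (by ring))
    · have h1 := hle₁ k
      have h2 := hle₂ k
      refine mul_le_mul (pow_le_pow_left₀ (by positivity) (le_of_eq_of_le ?_ h1) _)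
        (pow_le_pow_left₀ (by positivity) (le_of_eq_of_le ?_ h2) _) (by positivity)
        (pow_nonneg (mul_pos hK₁ (expPoly_pos _ _ k)).le _)
      · field_simp
        ring
      · field_simp
  let σ : ℝ := (a - b : ℕ) * (1 + β) + (d - a : ℕ) * (-γ + β) + (a - c : ℕ) * (-γ + -1)
  let s : ℝ := (a - b : ℕ) * (0 + -B₀) + (d - a : ℕ) * (C₀ + -B₀) + (a - c : ℕ) * (C₀ + 0)
  let K : ℝ := K₁ ^ (a - b) * K₂ ^ (d - a) * (K₃ * Kφ ^ (a - c))
  have hsum : Summable fun k => K * expPoly σ s k := by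
    refine (summable_expPoly ?_).mul_left K
    simp only [σ, s, Nat.cast_sub hba, Nat.cast_sub had.le, Nat.cast_sub hca]
    rcases hcond with h | ⟨h, h'⟩
    · left
      linarith
    · right
      constructor <;> linarith
  let F : ℕ → Set (Fin (a - c) → Fin c → ℝ) := fun k =>
    ⋃ z ∈ (hZfin k).toFinset, {Θ | (∀ i j, |Θ i j| ≤ R) ∧ Metric.infDist (intVec z)
      (graphSub d a c hca e Θ : Set (EuclideanSpace ℝ (Fin d))) < φ (2 ^ k)}
  have hF : ∀ k, volume (F k) ≤ ENNReal.ofReal (K * expPoly σ s k) := fun k => by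
    have hφk := hφpos (2 ^ k) (hone _)
    have h1 : ∀ z ∈ (hZfin k).toFinset,
        volume {Θ : Fin (a - c) → Fin c → ℝ | (∀ i j, |Θ i j| ≤ R) ∧ Metric.infDist (intVec z)
          (graphSub d a c hca e Θ : Set (EuclideanSpace ℝ (Fin d))) < φ (2 ^ k)} ≤
        ENNReal.ofReal (K₃ * (φ (2 ^ k) / 2 ^ k) ^ (a - c)) := fun z hz => by
      rw [Set.Finite.mem_toFinset] at hz
      have h2 : (2 : ℝ) ^ k ≤ ‖intVec z‖ := hz.1.trans (supNorm_le_norm _)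
      have h3 : intVec z ≠ 0 := fun h => by
        rw [h, norm_zero] at h2
        linarith [hone k]
      refine (hle₃ _ h3 _ hφk).trans (ENNReal.ofReal_le_ofReal ?_)
      gcongr
    refine (measure_biUnion_finset_le _ _).trans ((Finset.sum_le_card_nsmul _ _ _ h1).trans ?_)
    rw [nsmul_eq_mul, ← ENNReal.ofReal_natCast, ← ENNReal.ofReal_mul (by positivity)]
    refine ENNReal.ofReal_le_ofReal ?_
    calc _ ≤ ((K₁ * expPoly (1 + β) (0 + -B₀) k) ^ (a - b) *
          (K₂ * expPoly (-γ + β) (C₀ + -B₀) k) ^ (d - a)) *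
          (K₃ * (Kφ * expPoly (-γ + -1) (C₀ + 0) k) ^ (a - c)) := by
          refine mul_le_mul (hcard k) ?_ (by positivity) ((Nat.cast_nonneg _).trans (hcard k))
          exact mul_le_mul_of_nonneg_left (pow_le_pow_left₀ (by positivity) (hle₄ k) _) hK₃.le
      _ = K * (expPoly (1 + β) (0 + -B₀) k ^ (a - b) * expPoly (-γ + β) (C₀ + -B₀) k ^ (d - a) *
          expPoly (-γ + -1) (C₀ + 0) k ^ (a - c)) := by
          simp only [K, mul_pow]
          ring
      _ = K * expPoly σ s k := by
          simp only [expPoly_pow, expPoly_mul, σ, s]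
  have htsum : ∑' k, volume (F k) ≠ ⊤ := by
    refine ne_top_of_le_ne_top ?_ (ENNReal.tsum_le_tsum hF)
    exact hsum.tsum_ofReal_ne_top
  filter_upwards [ae_finite_setOfPred_mem htsum] with Θ hΘ hbox
  refine finite_of_finite_dyadic _ (fun z hz => hz.1) (hΘ.subset ?_)
  rintro k ⟨z, ⟨hz0, hz⟩, hk1, hk2⟩
  have h1 : φ (supNorm (intVec z)) ≤ φ (2 ^ k) :=
    hφanti (hone k) (one_le_supNorm_intVec hz0) hk1
  have h2 := hz.trans_le h1
  refine Set.mem_biUnion (x := z) ?_ ⟨hbox, h2⟩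
  rw [Finset.mem_coe, Set.Finite.mem_toFinset]
  refine ⟨hk1, hk2, le_trans ?_ h2.le⟩
  exact Metric.infDist_le_infDist_of_subset (hspan ▸ graphSub_le_span hca e Θ)
    ⟨0, Submodule.zero_mem _⟩

lemma ae_infDist_graphSub_pos {d a c : ℕ} (hc : 1 ≤ c) (hca : c < a)
    {e : Fin a → EuclideanSpace ℝ (Fin d)} (he : Orthonormal ℝ e)
    {v : EuclideanSpace ℝ (Fin d)} (hv : v ≠ 0) {R : ℝ} (hR : 0 ≤ R) :
    ∀ᵐ Θ ∂(volume : Measure (Fin (a - c) → Fin c → ℝ)), (∀ i j, |Θ i j| ≤ R) →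
      0 < Metric.infDist v (graphSub d a c hca.le e Θ : Set (EuclideanSpace ℝ (Fin d))) := by
  obtain ⟨K, hK, hle⟩ := exists_volume_infDist_graphSub_lt_le hc hca.le he hR
  have hlim : Tendsto (fun ε : ℝ => ENNReal.ofReal (K * (ε / ‖v‖) ^ (a - c)))
      (nhdsWithin 0 (Set.Ioi 0)) (nhds 0) := by
    have hcont : Continuous fun ε : ℝ => ENNReal.ofReal (K * (ε / ‖v‖) ^ (a - c)) :=
      ENNReal.continuous_ofReal.comp (by fun_prop)
    have h := (hcont.tendsto 0).mono_left (nhdsWithin_le_nhds (s := Set.Ioi 0))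
    simpa [zero_pow (Nat.sub_pos_of_lt hca).ne'] using h
  rw [ae_iff, ← nonpos_iff_eq_zero]
  refine ge_of_tendsto hlim ?_
  filter_upwards [self_mem_nhdsWithin] with ε hε
  refine (measure_mono fun Θ hΘ => ?_).trans (hle v hv ε hε)
  simp only [Set.mem_ofPred_eq, Classical.not_imp, not_lt] at hΘ
  exact ⟨hΘ.1, hΘ.2.trans_lt hε⟩

lemma exists_pos_mul_le_of_finite {α : Type*} {p : α → Prop} {f g : α → ℝ}
    (hf : ∀ x, p x → 0 < f x) (hg : ∀ x, p x → 0 < g x) (hfin : {x | p x ∧ g x < f x}.Finite) :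
    ∃ ρ : ℝ, 0 < ρ ∧ ∀ x, p x → ρ * f x ≤ g x := by
  have h : ∃ ρ : ℝ, (0 < ρ ∧ ρ ≤ 1) ∧ ∀ x ∈ {x | p x ∧ g x < f x}, ρ * f x ≤ g x := by
    rcases Set.eq_empty_or_nonempty {x | p x ∧ g x < f x} with he | hne
    · exact ⟨1, by norm_num, by simp [he]⟩
    · obtain ⟨y, hy, hmin⟩ := Set.exists_min_image _ (fun x => g x / f x) hfin hne
      refine ⟨g y / f y, ⟨div_pos (hg y hy.1) (hf y hy.1),
        (div_le_one (hf y hy.1)).2 hy.2.le⟩, fun x hx => ?_⟩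
      exact (le_div_iff₀ (hf x hx.1)).1 (hmin x hx)
  obtain ⟨ρ, ⟨h0, h1⟩, hρ⟩ := h
  refine ⟨ρ, h0, fun x hx => ?_⟩
  rcases lt_or_ge (g x) (f x) with hlt | hge
  · exact hρ x ⟨hx, hlt⟩
  · exact (mul_le_of_le_one_left (hf x hx).le h1).trans hge

/-- let `1 ≤ c < b ≤ a < d`, `0 < γ < β`, `ψ(T) = T^{−β} log(T+2)^{B₀}`,
`φ(T) = T^{−γ} log(T+2)^{C₀}`, with `ψ, φ` decreasing on `[1,∞)` and `ψ(T) ≤ T^{−b/(d−b)}`.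
If `B ⊆ ℝ^d` is a `b`-dimensional `ψ`-badly approximable subspace, `A ⊇ B` is `a`-dimensional,
and `γ(d−c) > β(d−b)+c−b`, or `γ(d−c) = β(d−b)+c−b` and `C₀(d−c) − B₀(d−b) < −1`, then for
almost every `Θ` only finitely many nonzero `z ∈ ℤ^d` satisfy `dist(z, C(Θ)) < φ(|z|)`; hence
`C(Θ)` is `ρφ`-badly approximable for some `ρ > 0`. -/
theorem stmt_16 (d a b c : ℕ) (hc : 1 ≤ c) (hcb : c < b) (hba : b ≤ a) (had : a < d)
    (β γ B₀ C₀ : ℝ) (hγpos : 0 < γ) (hγβ : γ < β)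
    (hψanti : AntitoneOn (fun T : ℝ => T ^ (-β) * Real.log (T + 2) ^ B₀) (Set.Ici 1))
    (hφanti : AntitoneOn (fun T : ℝ => T ^ (-γ) * Real.log (T + 2) ^ C₀) (Set.Ici 1))
    (hψbound : ∀ T : ℝ, 1 ≤ T →
      T ^ (-β) * Real.log (T + 2) ^ B₀ ≤ T ^ (-(b : ℝ) / ((d : ℝ) - (b : ℝ))))
    (B A : Submodule ℝ (EuclideanSpace ℝ (Fin d))) (hBA : B ≤ A)
    (hdimB : Module.finrank ℝ B = b) (hdimA : Module.finrank ℝ A = a)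
    (hbad : ∀ z : Fin d → ℤ, z ≠ 0 →
      supNorm (intVec z) ^ (-β) * Real.log (supNorm (intVec z) + 2) ^ B₀ ≤
        Metric.infDist (intVec z) (B : Set (EuclideanSpace ℝ (Fin d))))
    (e : Fin a → EuclideanSpace ℝ (Fin d)) (he : Orthonormal ℝ e)
    (hspan : Submodule.span ℝ (Set.range e) = A)
    (hcond :
      γ * ((d : ℝ) - (c : ℝ)) > β * ((d : ℝ) - (b : ℝ)) + (c : ℝ) - (b : ℝ) ∨
      (γ * ((d : ℝ) - (c : ℝ)) = β * ((d : ℝ) - (b : ℝ)) + (c : ℝ) - (b : ℝ) ∧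
        C₀ * ((d : ℝ) - (c : ℝ)) - B₀ * ((d : ℝ) - (b : ℝ)) < -1)) :
    ∀ᵐ Θ ∂(volume : Measure (Fin (a - c) → Fin c → ℝ)),
      {z : Fin d → ℤ | z ≠ 0 ∧
          Metric.infDist (intVec z)
            ((graphSub d a c (by omega) e Θ : Submodule ℝ (EuclideanSpace ℝ (Fin d))) :
              Set (EuclideanSpace ℝ (Fin d))) <
            supNorm (intVec z) ^ (-γ) * Real.log (supNorm (intVec z) + 2) ^ C₀}.Finite ∧
      ∃ ρ : ℝ, 0 < ρ ∧ ∀ z : Fin d → ℤ, z ≠ 0 →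
        ρ * (supNorm (intVec z) ^ (-γ) * Real.log (supNorm (intVec z) + 2) ^ C₀) ≤
          Metric.infDist (intVec z)
            ((graphSub d a c (by omega) e Θ : Submodule ℝ (EuclideanSpace ℝ (Fin d))) :
              Set (EuclideanSpace ℝ (Fin d))) := by
  have hca : c < a := by omega
  have h1 : ∀ᵐ Θ ∂(volume : Measure (Fin (a - c) → Fin c → ℝ)), ∀ n : ℕ, (∀ i j, |Θ i j| ≤ (n : ℝ)) →
      {z : Fin d → ℤ | z ≠ 0 ∧
          Metric.infDist (intVec z)
            (graphSub d a c hca.le e Θ : Set (EuclideanSpace ℝ (Fin d))) <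
            supNorm (intVec z) ^ (-γ) * Real.log (supNorm (intVec z) + 2) ^ C₀}.Finite :=
    ae_all_iff.2 fun n => ae_finite_infDist_graphSub_lt hc hba had hγpos hγβ hψanti hφanti hBA
      hdimB hdimA hbad he hspan hcond hca.le n.cast_nonneg
  have h2 : ∀ᵐ Θ ∂(volume : Measure (Fin (a - c) → Fin c → ℝ)), ∀ (n : ℕ) (z : Fin d → ℤ),
      z ≠ 0 → (∀ i j, |Θ i j| ≤ (n : ℝ)) →
        0 < Metric.infDist (intVec z)
          (graphSub d a c hca.le e Θ : Set (EuclideanSpace ℝ (Fin d))) := by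
    refine ae_all_iff.2 fun n => ae_all_iff.2 fun z => ?_
    by_cases hz : z = 0
    · simp [hz]
    · filter_upwards [ae_infDist_graphSub_pos hc hca he (intVec_ne_zero hz)
        (n.cast_nonneg (α := ℝ))] with Θ hΘ _ using hΘ
  filter_upwards [h1, h2] with Θ hfin hpos
  obtain ⟨n, hn⟩ := exists_nat_ge ‖Θ‖
  have hbox : ∀ i j, |Θ i j| ≤ (n : ℝ) := fun i j =>
    (norm_le_pi_norm (Θ i) j).trans ((norm_le_pi_norm Θ i).trans hn)
  refine ⟨hfin n hbox, exists_pos_mul_le_of_finite (p := fun z : Fin d → ℤ => z ≠ 0)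
    (fun z hz => rpow_mul_log_rpow_pos _ _ (one_le_supNorm_intVec hz))
    (fun z hz => hpos n z hz hbox) (hfin n hbox)⟩

end
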